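/- arXiv:2409.20348 — 2 statements merged into one kernel-verified Lean document; each statement's English description precedes it below -/
import Mathlib

section
/- Let G be a group, let H₁,…,Hₙ ≤ G be subgroups each of infinite index in G, and let S ⊆ G be a finite subset. Then the set G \ S(H₁ ∪ … ∪ Hₙ)S is infinite, where S(H₁ ∪ … ∪ Hₙ)S := {s·h·s' : s, s' ∈ S, h ∈ H₁ ∪ … ∪ Hₙ}. -/
open scoped Pointwise

/-- If `H 1, …, H n` (`n ≥ 1`) are subgroups of infinite index in `G`
and `S ⊆ G` is finite, then the complement of `S · (H 1 ∪ … ∪ H n) · S` in `G` is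
infinite. -/
theorem compl_of_finite_sandwich_of_infinite_index_subgroups_infinite
    {G : Type*} [Group G] {n : ℕ} (hn : 0 < n) (H : Fin n → Subgroup G)
    (hH : ∀ i, ¬ (H i).FiniteIndex) (S : Set G) (hS : S.Finite) :
    {g : G | ¬ ∃ s ∈ S, ∃ h : G, (∃ i : Fin n, h ∈ H i) ∧ ∃ s' ∈ S, g = s * h * s'}.Infinite := by
  classical
  intro hF
  -- Since `s * h * t = (s * t) * (t⁻¹ * h * t)`, finitely many left cosets of conjugates of
  -- the `H i` would cover `G`.
  let K : G × G × Fin n → Subgroup G := fun p => (H p.2.2).comap (MulAut.conj p.2.1).toMonoidHom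
  let T : Finset (G × G × Fin n) :=
    (hF.toFinset ∪ Finset.image₂ (· * ·) hS.toFinset hS.toFinset) ×ˢ
      (insert 1 hS.toFinset) ×ˢ Finset.univ
  have hcovers : ⋃ p ∈ T, p.1 • (K p : Set G) = Set.univ := by
    refine Set.eq_univ_of_forall fun g => Set.mem_iUnion₂.mpr ?_
    by_cases hg : ∃ s ∈ S, ∃ h : G, (∃ i : Fin n, h ∈ H i) ∧ ∃ s' ∈ S, g = s * h * s'
    · obtain ⟨s, hs, h, ⟨i, hi⟩, t, ht, rfl⟩ := hg
      refine ⟨(s * t, t, i), ?_, ?_⟩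
      · simp only [T, Finset.mem_product, Finset.mem_union, Finset.mem_insert, Finset.mem_univ,
          Set.Finite.mem_toFinset, and_true]
        exact ⟨Or.inr (Finset.mem_image₂_of_mem (hS.mem_toFinset.mpr hs)
          (hS.mem_toFinset.mpr ht)), Or.inr ht⟩
      · simpa [K, Set.mem_smul_set_iff_inv_smul_mem, mul_assoc] using hi
    · refine ⟨(g, 1, ⟨0, hn⟩), ?_, ?_⟩
      · simp only [T, Finset.mem_product, Finset.mem_union, Finset.mem_insert, Finset.mem_univ,
          Set.Finite.mem_toFinset, and_true, true_or]
        exact Or.inl hg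
      · simp [K, Set.mem_smul_set_iff_inv_smul_mem, one_mem]
  obtain ⟨p, -, hp⟩ := Subgroup.exists_finiteIndex_of_leftCoset_cover hcovers
  refine hH p.2.2 ⟨?_⟩
  rw [← Subgroup.index_comap_of_surjective (f := (MulAut.conj p.2.1).toMonoidHom) (H p.2.2)
    (MulAut.conj p.2.1).surjective]
  exact hp.index_ne_zero
end

section
/- Let G be a group and H₁,…,H_k ≤ G subgroups. Suppose there exists a homogeneous quasimorphism φ : G → ℝ such that φ(h) = 0 for every h ∈ H₁ ∪ … ∪ H_k, and φ(g) ≠ 0 for some g ∈ G. Then G is not boundedly generated by {H₁,…,H_k}. -/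
/-- `G` is boundedly generated by the subgroups `H i`: for every `g` there is `N` such
that every positive power `gⁿ` is a product of `N` elements, each conjugate into some `H i`. -/
def BoundedlyGeneratedBy {G : Type*} [Group G] {n : ℕ} (H : Fin n → Subgroup G) : Prop :=
  ∀ g : G, ∃ N : ℕ, ∀ m : ℕ, 1 ≤ m →
    ∃ h : Fin N → G, g ^ m = (List.ofFn h).prod ∧
      ∀ i : Fin N, ∃ t : G, ∃ j : Fin n, t * h i * t⁻¹ ∈ H j

/-- A real number whose positive integer multiples are uniformly bounded is zero. -/
lemma eq_zero_of_forall_abs_nat_mul_le {x C : ℝ}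
    (h : ∀ m : ℕ, 1 ≤ m → |(m : ℝ) * x| ≤ C) : x = 0 := by
  by_contra hx
  have hpos : 0 < |x| := abs_pos.mpr hx
  obtain ⟨m, hm⟩ := exists_nat_gt (C / |x|)
  have hC : 0 ≤ C := (abs_nonneg _).trans (h 1 le_rfl)
  have hm0 : (0 : ℝ) < m := (div_nonneg hC hpos.le).trans_lt hm
  have hbound := h m (by exact_mod_cast hm0)
  rw [abs_mul, abs_of_pos hm0] at hbound
  exact absurd hbound (not_le.mpr ((div_lt_iff₀ hpos).mp hm))

/-- A homogeneous quasimorphism is invariant under conjugation. -/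
lemma homogeneous_quasimorphism_conj {G : Type*} [Group G] {φ : G → ℝ} {Δ : ℝ}
    (hqm : ∀ a b : G, |φ (a * b) - φ a - φ b| ≤ Δ)
    (hhom : ∀ (g : G) (n : ℤ), φ (g ^ n) = (n : ℝ) * φ g) (t g : G) :
    φ (t * g * t⁻¹) = φ g := by
  refine sub_eq_zero.mp (eq_zero_of_forall_abs_nat_mul_le (C := 2 * Δ) fun m _ => ?_)
  have hconj : φ (t * g ^ m * t⁻¹) = m * φ (t * g * t⁻¹) := by
    rw [← conj_pow]
    exact_mod_cast hhom (t * g * t⁻¹) m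
  have hpow : φ (g ^ m) = m * φ g := by exact_mod_cast hhom g m
  have hinv : φ t⁻¹ = -φ t := by simpa using hhom t (-1)
  have hleft := abs_le.mp (hqm t (g ^ m))
  have hright := abs_le.mp (hqm (t * g ^ m) t⁻¹)
  rw [abs_le]
  constructor <;> linarith

/-- On a product of elements where a quasimorphism vanishes, it grows at most linearly in
the number of factors. -/
lemma abs_quasimorphism_list_prod_le {G : Type*} [Group G] {φ : G → ℝ} {Δ : ℝ}
    (hqm : ∀ a b : G, |φ (a * b) - φ a - φ b| ≤ Δ) (hone : φ 1 = 0) (l : List G)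
    (hl : ∀ x ∈ l, φ x = 0) : |φ l.prod| ≤ l.length * Δ := by
  induction l with
  | nil => simp [hone]
  | cons a l ih =>
    have htail := abs_le.mp (ih fun x hx => hl x (List.mem_cons_of_mem a hx))
    have hhead := abs_le.mp (hqm a l.prod)
    have ha : φ a = 0 := hl a List.mem_cons_self
    rw [List.prod_cons, List.length_cons, abs_le]
    push_cast
    constructor <;> linarith

/-- If `G` carries a homogeneous quasimorphism vanishing on each
subgroup `H i` but not identically zero, then `G` is not boundedly generated by the
`H i`. -/
theorem not_boundedly_generated_of_homogeneous_quasimorphism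
    {G : Type*} [Group G] {k : ℕ} (H : Fin k → Subgroup G) (φ : G → ℝ)
    (hqm : ∃ Δ : ℝ, ∀ a b : G, |φ (a * b) - φ a - φ b| ≤ Δ)
    (hhom : ∀ (g : G) (n : ℤ), φ (g ^ n) = (n : ℝ) * φ g)
    (hvan : ∀ i : Fin k, ∀ h ∈ H i, φ h = 0)
    (hnz : ∃ g : G, φ g ≠ 0) :
    ¬ BoundedlyGeneratedBy H := by
  obtain ⟨Δ, hΔ⟩ := hqm
  obtain ⟨g, hg⟩ := hnz
  intro hbg
  obtain ⟨N, hN⟩ := hbg g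
  have hone : φ 1 = 0 := by simpa using hhom 1 0
  refine hg (eq_zero_of_forall_abs_nat_mul_le (C := N * Δ) fun m hm => ?_)
  obtain ⟨h, hprod, hconj⟩ := hN m hm
  have hzero : ∀ x ∈ List.ofFn h, φ x = 0 := by
    intro x hx
    obtain ⟨i, rfl⟩ := List.mem_ofFn.mp hx
    obtain ⟨t, j, hmem⟩ := hconj i
    rw [← homogeneous_quasimorphism_conj hΔ hhom t (h i)]
    exact hvan j _ hmem
  have hbound := abs_quasimorphism_list_prod_le hΔ hone _ hzero
  have hpow : φ (g ^ m) = m * φ g := by exact_mod_cast hhom g m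
  rwa [← hprod, List.length_ofFn, hpow] at hbound
end
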